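/- Let k, ℓ ≥ 2 be integers with ℓ ≤ k, and let q ≥ 2 be an integer with q^{k+ℓ−1} ≥ ℓ!·(16k+8ℓ−16). Set c = (1 − √(1 − ℓ!·(16k+8ℓ−16)/q^{k+ℓ−1})) / (8k+4ℓ−8). Then for every n ≥ 2k+ℓ−1, the number of x ∈ Z_q^n such that Δ_k(R_ℓ(x)) does not contain the factor 0^k is at least q^n·(1−c)^{n−2k−ℓ+2}; consequently liminf_{n→∞} (1/n)·log_q |{N_{k,ℓ}(x) : x ∈ Z_q^n}| ≥ 1 − log_q(1/(1−c)). -/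

import Mathlib

/-- The composition of a word over `Fin q`, as an element of `ℤ^q`:
it counts, for each letter `a`, the number of occurrences of `a`. -/
def comp {q : ℕ} (w : List (Fin q)) : Fin q → ℤ := fun a => (w.count a : ℤ)

/-- The `ℓ`-read vector of a word over `Fin q`: a word of length `n + ℓ - 1`
over `ℤ^q` whose `p`-th entry is the composition of the window of the last `ℓ`
symbols ending at position `p` (symbols outside the word are omitted). -/
def readVec {q : ℕ} (ℓ : ℕ) (x : List (Fin q)) : List (Fin q → ℤ) :=
  (List.range (x.length + ℓ - 1)).map fun p => comp ((x.take (p + 1)).drop (p + 1 - ℓ))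

/-- The `k`-step derivative of a word over an abelian group, with the
convention that entries at nonpositive positions are `0`. -/
def kderiv {G : Type*} [AddCommGroup G] (k : ℕ) (y : List G) : List G :=
  (List.range y.length).map fun i => y.getD i 0 - if k ≤ i then y.getD (i - k) 0 else 0

/-- The lengths `(m_0, m_1, ..., m_s)` of the maximal (possibly empty) runs of
zeros in `y = 0^{m_0} y_1 0^{m_1} ⋯ y_s 0^{m_s}` with `y_1, ..., y_s ≠ 0`. -/
def zeroRuns {G : Type*} [Zero G] [DecidableEq G] (y : List G) : List ℕ :=
  (y.splitOnP fun a => decide (a ≠ 0)).map List.length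

/-- `σ_k(y) = (⌊m_0/k⌋, ⌊m_1/k⌋, ..., ⌊m_s/k⌋)`. -/
def sigmak {G : Type*} [Zero G] [DecidableEq G] (k : ℕ) (y : List G) : List ℕ :=
  (zeroRuns y).map fun m => m / k

/-- Interleave zero runs of the given lengths with the given (nonzero) letters:
`assemble (m_0 :: ... :: m_s) (y_1 :: ... :: y_s) = 0^{m_0} y_1 0^{m_1} ⋯ y_s 0^{m_s}`. -/
def assemble {G : Type*} [Zero G] : List ℕ → List G → List G
  | [], _ => []
  | m :: _, [] => List.replicate m (0 : G)
  | m :: ms, a :: as => List.replicate m (0 : G) ++ a :: assemble ms as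

/-- `μ_k(y) = 0^{m_0 % k} y_1 0^{m_1 % k} ⋯ y_s 0^{m_s % k}`. -/
def muk {G : Type*} [Zero G] [DecidableEq G] (k : ℕ) (y : List G) : List G :=
  assemble ((zeroRuns y).map fun m => m % k) (y.filter fun a => decide (a ≠ 0))

/-- The nucleus `N_{k,ℓ}(x) = μ_k(Δ_k(R_ℓ(x)))` of a word over `Fin q`. -/
def nucleus {q : ℕ} (k ℓ : ℕ) (x : List (Fin q)) : List (Fin q → ℤ) :=
  muk k (kderiv k (readVec ℓ x))

/-- A single tandem duplication of length `k`: `u v w ↦ u v v w` with `|v| = k`. -/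
def TD {α : Type*} (k : ℕ) (y z : List α) : Prop :=
  ∃ u v w : List α, v.length = k ∧ y = u ++ (v ++ w) ∧ z = u ++ (v ++ (v ++ w))

/-- `TDt k t y z` holds iff `z` arises from `y` by a sequence of exactly `t`
tandem duplications of length `k`, i.e. `y ⟹_k^t z`. -/
def TDt {α : Type*} (k : ℕ) : ℕ → List α → List α → Prop
  | 0 => fun y z => y = z
  | t + 1 => fun y z => ∃ w, TDt k t y w ∧ TD k w z

/-- The ball `B_{k,t}(y)`: all words obtained from `y` by at most `t` tandem
duplications of length `k`. -/
def Ball {α : Type*} (k t : ℕ) (y : List α) : Set (List α) :=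
  {z | ∃ j ≤ t, TDt k j y z}

/-- `x` is `(k,ℓ)`-fine: it contains no `k`-periodic factor of length `2k+ℓ-1`. -/
def Fine {q : ℕ} (k ℓ : ℕ) (x : List (Fin q)) : Prop :=
  ∀ i : ℕ, 1 ≤ i → i + 2 * k + ℓ - 2 ≤ x.length →
    (x.drop (i - 1)).take (k + ℓ - 1) ≠ (x.drop (i - 1 + k)).take (k + ℓ - 1)

/-- `y` contains the factor `0^k` (a run of `k` consecutive zeros). -/
def HasZeroBlock {G : Type*} [Zero G] (k : ℕ) (y : List G) : Prop :=
  ∃ j, j + k ≤ y.length ∧ (y.drop j).take k = List.replicate k (0 : G)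

/-- `λ_{m,q}`: the largest real root of `x^{m+2} - q·x^{m+1} + q - 1`. -/
noncomputable def lambdaRoot (m q : ℕ) : ℝ :=
  sSup {x : ℝ | x ^ (m + 2) - (q : ℝ) * x ^ (m + 1) + (q : ℝ) - 1 = 0}

/-- The dot product `a ⊙ b = Σ_{i=1}^{min(|a|,|b|)} a_i · b_i`. -/
def dot {G : Type*} [AddCommMonoid G] (a : List ℕ) (b : List G) : G :=
  (List.zipWith (fun m g => m • g) a b).sum

/-- The finite set of words of length `n` over a finite alphabet. -/
noncomputable def wordsOfLength (α : Type*) [Finite α] (n : ℕ) : Finset (List α) :=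
  (List.finite_length_eq α n).toFinset

section Counting

variable {α : Type*} [Fintype α]

theorem mem_wordsOfLength {n : ℕ} {x : List α} : x ∈ wordsOfLength α n ↔ x.length = n := by
  simp [wordsOfLength]

theorem card_wordsOfLength (n : ℕ) : (wordsOfLength α n).card = Fintype.card α ^ n := by
  rw [← card_vector n, ← Fintype.card_coe]
  exact Fintype.card_congr (Equiv.subtypeEquivRight fun x => mem_wordsOfLength)

open Classical in
/-- The words of length `n` all of whose factors of length `d` avoid the set `B`. -/
noncomputable def avoidingWords (B : Finset (List α)) (d n : ℕ) : Finset (List α) :=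
  (wordsOfLength α n).filter fun x => ∀ i, i + d ≤ n → (x.drop i).take d ∉ B

theorem mem_avoidingWords {B : Finset (List α)} {d n : ℕ} {x : List α} :
    x ∈ avoidingWords B d n ↔
      x.length = n ∧ ∀ i, i + d ≤ n → (x.drop i).take d ∉ B := by
  simp [avoidingWords, mem_wordsOfLength]

theorem avoidingWords_eq_of_lt (B : Finset (List α)) {d n : ℕ} (h : n < d) :
    avoidingWords B d n = wordsOfLength α n := by
  ext x
  rw [mem_avoidingWords, mem_wordsOfLength]
  exact ⟨fun hx => hx.1, fun hx => ⟨hx, fun i hi => by omega⟩⟩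

theorem card_avoidingWords_succ (B : Finset (List α)) (d m : ℕ) :
    Fintype.card α * (avoidingWords B (d + 1) (m + d)).card ≤
      (avoidingWords B (d + 1) (m + d + 1)).card + (avoidingWords B (d + 1) m).card * B.card := by
  classical
  have hinj : Function.Injective fun p : List α × α => p.1 ++ [p.2] := by
    rintro ⟨x, a⟩ ⟨y, b⟩ h
    simpa using List.append_inj' h rfl
  have hsub : ((avoidingWords B (d + 1) (m + d)) ×ˢ (Finset.univ : Finset α)).image
      (fun p => p.1 ++ [p.2]) ⊆ avoidingWords B (d + 1) (m + d + 1) ∪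
        ((avoidingWords B (d + 1) m) ×ˢ B).image (fun p => p.1 ++ p.2) := by
    intro z hz
    obtain ⟨⟨x, a⟩, hx, rfl⟩ := Finset.mem_image.1 hz
    simp only [Finset.mem_product, Finset.mem_univ, and_true, mem_avoidingWords] at hx
    obtain ⟨hlen, hx⟩ := hx
    have hpre : ∀ i, i + (d + 1) ≤ m + d →
        ((x ++ [a]).drop i).take (d + 1) = (x.drop i).take (d + 1) := by
      intro i hi
      rw [List.drop_append_of_le_length (by omega), List.take_append_of_le_length]
      simp; omega
    rw [Finset.mem_union]
    by_cases hB : (x ++ [a]).drop m ∈ B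
    · right
      refine Finset.mem_image.2 ⟨((x ++ [a]).take m, (x ++ [a]).drop m), ?_, by simp⟩
      simp only [Finset.mem_product, mem_avoidingWords]
      refine ⟨⟨by simp; omega, fun i hi => ?_⟩, hB⟩
      rw [List.take_append_of_le_length (by omega), List.drop_take, List.take_take,
        min_eq_left (by omega)]
      exact hx i (by omega)
    · left
      refine mem_avoidingWords.2 ⟨by simp [hlen], fun i hi => ?_⟩
      rcases Nat.lt_or_ge i m with him | him
      · rw [hpre i (by omega)]
        exact hx i (by omega)
      · obtain rfl : i = m := by omega
        rwa [List.take_of_length_le (by simp; omega)]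
  have h1 := Finset.card_le_card hsub
  rw [Finset.card_image_of_injective _ hinj, Finset.card_product, Finset.card_univ] at h1
  rw [mul_comm]
  exact h1.trans ((Finset.card_union_le _ _).trans (Nat.add_le_add_left
    (Finset.card_image_le.trans (Finset.card_product _ _).le) _))

/-- A one-sided local lemma for words: if the forbidden factors have density at most
`c * (1 - c) ^ d`, then each new letter costs at most a factor `1 - c`. -/
theorem mul_card_avoidingWords_le (B : Finset (List α)) (d : ℕ) (c : ℝ) (hc0 : 0 ≤ c)
    (hc1 : c ≤ 1)
    (hB : (B.card : ℝ) ≤ (Fintype.card α : ℝ) ^ (d + 1) * (c * (1 - c) ^ d)) (n : ℕ) :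
    (Fintype.card α : ℝ) * (1 - c) * (avoidingWords B (d + 1) n).card ≤
      (avoidingWords B (d + 1) (n + 1)).card := by
  set Q : ℝ := (Fintype.card α : ℝ) with hQ
  have hQ0 : 0 ≤ Q := by positivity
  have hc' : 0 ≤ 1 - c := by linarith
  induction n using Nat.strong_induction_on with
  | _ n ih =>
    rcases Nat.lt_or_ge n d with hn | hn
    · rw [avoidingWords_eq_of_lt B (by omega), avoidingWords_eq_of_lt B (by omega),
        card_wordsOfLength, card_wordsOfLength]
      push_cast
      rw [← hQ, pow_succ']
      have : 0 ≤ Q * Q ^ n * c := by positivity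
      nlinarith
    · obtain ⟨m, rfl⟩ : ∃ m, n = m + d := ⟨n - d, by omega⟩
      have hchain : ∀ j ≤ d, (Q * (1 - c)) ^ j * (avoidingWords B (d + 1) m).card ≤
          (avoidingWords B (d + 1) (m + j)).card := by
        intro j
        induction j with
        | zero => simp
        | succ j ihj =>
          intro hj
          refine le_trans ?_ (ih (m + j) (by omega))
          rw [pow_succ', mul_assoc]
          exact mul_le_mul_of_nonneg_left (ihj (by omega)) (by positivity)
      have h1 : Q * (avoidingWords B (d + 1) (m + d)).card ≤
          (avoidingWords B (d + 1) (m + d + 1)).card +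
            (avoidingWords B (d + 1) m).card * (B.card : ℝ) := by
        rw [hQ]
        exact_mod_cast card_avoidingWords_succ B d m
      have h2 : ((avoidingWords B (d + 1) m).card : ℝ) * (B.card : ℝ) ≤
          Q * c * (avoidingWords B (d + 1) (m + d)).card := by
        calc ((avoidingWords B (d + 1) m).card : ℝ) * (B.card : ℝ)
            ≤ (avoidingWords B (d + 1) m).card * (Q ^ (d + 1) * (c * (1 - c) ^ d)) := by gcongr
          _ = Q * c * ((Q * (1 - c)) ^ d * (avoidingWords B (d + 1) m).card) := by
              rw [mul_pow]; ring
          _ ≤ _ := mul_le_mul_of_nonneg_left (hchain d le_rfl) (by positivity)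
      linarith

theorem pow_mul_le_card_avoidingWords (B : Finset (List α)) (d : ℕ) (c : ℝ) (hc0 : 0 ≤ c)
    (hc1 : c ≤ 1)
    (hB : (B.card : ℝ) ≤ (Fintype.card α : ℝ) ^ (d + 1) * (c * (1 - c) ^ d)) (j : ℕ) :
    (Fintype.card α : ℝ) ^ (d + j) * (1 - c) ^ j ≤ (avoidingWords B (d + 1) (d + j)).card := by
  induction j with
  | zero =>
    rw [avoidingWords_eq_of_lt B (by omega), card_wordsOfLength]
    simp
  | succ j ih =>
    have hc' : 0 ≤ 1 - c := by linarith
    refine le_trans ?_ (mul_card_avoidingWords_le B d c hc0 hc1 hB (d + j))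
    calc _ = (Fintype.card α : ℝ) * (1 - c) *
          ((Fintype.card α : ℝ) ^ (d + j) * (1 - c) ^ j) := by
          rw [← add_assoc, pow_succ, pow_succ]; ring
      _ ≤ _ := mul_le_mul_of_nonneg_left ih (by positivity)

open Classical in
/-- The words of length `k + ℓ + m` whose length-`ℓ` windows starting at `0, ..., m` are
permutations of the windows `k` positions later. -/
noncomputable def abelianPeriodicWords (α : Type*) [Finite α] (k ℓ m : ℕ) : Finset (List α) :=
  (wordsOfLength α (k + ℓ + m)).filter fun w =>
    ∀ j ≤ m, ((w.drop (k + j)).take ℓ).Perm ((w.drop j).take ℓ)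

theorem mem_abelianPeriodicWords {k ℓ m : ℕ} {w : List α} :
    w ∈ abelianPeriodicWords α k ℓ m ↔ w.length = k + ℓ + m ∧
      ∀ j ≤ m, ((w.drop (k + j)).take ℓ).Perm ((w.drop j).take ℓ) := by
  simp [abelianPeriodicWords, mem_wordsOfLength]

theorem card_abelianPeriodicWords_le {k ℓ : ℕ} (hk : 1 ≤ k) (hl : 1 ≤ ℓ) (hlk : ℓ ≤ k) (m : ℕ) :
    (abelianPeriodicWords α k ℓ m).card ≤ Fintype.card α ^ k * ℓ.factorial := by
  classical
  induction m with
  | zero =>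
    have hsub : abelianPeriodicWords α k ℓ 0 ⊆ (wordsOfLength α k).biUnion fun u =>
        (u.take ℓ).permutations.toFinset.image fun v => u ++ v := by
      intro w hw
      obtain ⟨hlen, hw⟩ := mem_abelianPeriodicWords.1 hw
      have h0 := hw 0 le_rfl
      simp only [add_zero, List.drop_zero] at h0
      rw [List.take_of_length_le (by simp; omega)] at h0
      simp only [Finset.mem_biUnion, Finset.mem_image, List.mem_toFinset, List.mem_permutations,
        mem_wordsOfLength]
      refine ⟨w.take k, by simp; omega, w.drop k, ?_, by simp⟩
      rwa [List.take_take, min_eq_left hlk]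
    refine (Finset.card_le_card hsub).trans ?_
    rw [← card_wordsOfLength]
    refine Finset.card_biUnion_le_card_mul _ _ _ fun u hu => ?_
    refine Finset.card_image_le.trans ((List.toFinset_card_le _).trans ?_)
    rw [List.length_permutations, List.length_take, mem_wordsOfLength.1 hu, min_eq_left hlk]
  | succ m ih =>
    refine le_trans (Finset.card_le_card_of_injOn List.dropLast ?_ ?_) ih
    · intro w hw
      obtain ⟨hlen, hw⟩ := mem_abelianPeriodicWords.1 hw
      refine mem_abelianPeriodicWords.2 ⟨by simp [hlen], fun j hj => ?_⟩
      have key : ∀ i, i + ℓ ≤ k + ℓ + m → (w.dropLast.drop i).take ℓ = (w.drop i).take ℓ := by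
        intro i hi
        rw [List.dropLast_eq_take, List.drop_take, List.take_take, min_eq_left (by omega)]
      rw [key _ (by omega), key _ (by omega)]
      exact hw j (by omega)
    · have key : ∀ w ∈ abelianPeriodicWords α k ℓ (m + 1), ∃ v a, w = v ++ [a] ∧
          (v.drop (k + (m + 1)) ++ [a]).Perm ((v.drop (m + 1)).take ℓ) := by
        intro w hw
        obtain ⟨hlen, hw⟩ := mem_abelianPeriodicWords.1 hw
        obtain ⟨v, a, rfl⟩ := List.eq_nil_or_concat w |>.resolve_left (by
          rintro rfl
          simp at hlen)
        refine ⟨v, a, by simp, ?_⟩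
        have := hw (m + 1) le_rfl
        simp only [List.length_append, List.length_singleton, List.concat_eq_append] at hlen this
        rwa [List.take_of_length_le (by simp; omega), List.drop_append_of_le_length (by omega),
          List.drop_append_of_le_length (by omega),
          List.take_append_of_le_length (by simp; omega)] at this
      intro w hw w' hw' h
      obtain ⟨v, a, rfl, ha⟩ := key w hw
      obtain ⟨v', b, rfl, hb⟩ := key w' hw'
      simp only [List.dropLast_concat] at h
      subst h
      have := (List.perm_append_left_iff _).1 (ha.trans hb.symm)
      simpa using this

end Counting

section Words

variable {q : ℕ}

theorem comp_eq_comp_iff {u v : List (Fin q)} : comp u = comp v ↔ u.Perm v := by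
  rw [List.perm_iff_count, funext_iff]
  simp [comp]

theorem comp_nil : comp ([] : List (Fin q)) = 0 := by
  ext a; simp [comp]

theorem length_readVec (ℓ : ℕ) (x : List (Fin q)) :
    (readVec ℓ x).length = x.length + ℓ - 1 := by simp [readVec]

theorem length_kderiv {G : Type*} [AddCommGroup G] (k : ℕ) (y : List G) :
    (kderiv k y).length = y.length := by simp [kderiv]

theorem getD_readVec {ℓ p : ℕ} {x : List (Fin q)} (hp : p < x.length + ℓ - 1) :
    (readVec ℓ x).getD p 0 = comp ((x.take (p + 1)).drop (p + 1 - ℓ)) := by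
  simp [readVec, List.getD_eq_getElem?_getD, hp]

theorem getD_kderiv {G : Type*} [AddCommGroup G] {k i : ℕ} {y : List G} (hi : i < y.length) :
    (kderiv k y).getD i 0 = y.getD i 0 - if k ≤ i then y.getD (i - k) 0 else 0 := by
  simp [kderiv, List.getD_eq_getElem?_getD, hi]

theorem kderiv_injective {G : Type*} [AddCommGroup G] {k : ℕ} (hk : 1 ≤ k) {y z : List G}
    (h : kderiv k y = kderiv k z) : y = z := by
  have hlen : y.length = z.length := by
    rw [← length_kderiv k y, h, length_kderiv]
  have key : ∀ i, i < y.length → y.getD i 0 = z.getD i 0 := by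
    intro i
    induction i using Nat.strong_induction_on with
    | _ i ih =>
      intro hi
      have h1 := getD_kderiv (k := k) hi
      rw [h, getD_kderiv (hlen ▸ hi)] at h1
      by_cases hki : k ≤ i
      · rw [if_pos hki, if_pos hki, ih (i - k) (by omega) (by omega)] at h1
        exact (sub_left_injective h1).symm
      · simpa [hki] using h1.symm
  refine List.ext_getElem hlen fun i h1 h2 => ?_
  simpa [List.getD_eq_getElem?_getD, h1, h2] using key i h1

theorem readVec_injective {ℓ : ℕ} (hl : 1 ≤ ℓ) {x y : List (Fin q)} (hlen : x.length = y.length)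
    (h : readVec ℓ x = readVec ℓ y) : x = y := by
  have key : ∀ p ≤ x.length, x.take p = y.take p := by
    intro p
    induction p with
    | zero => simp
    | succ p ih =>
      intro hp
      have h1 := getD_readVec (ℓ := ℓ) (p := p) (x := x) (by omega)
      rw [h, getD_readVec (by omega), comp_eq_comp_iff] at h1
      have ih' := ih (by omega)
      have hx : x.take (p + 1) = x.take p ++ [x[p]] := by simp
      have hy : y.take (p + 1) = y.take p ++ [y[p]] := by simp
      rw [hx, hy, ih', List.drop_append_of_le_length (by simp; omega),
        List.drop_append_of_le_length (by simp; omega), List.perm_append_left_iff] at h1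
      rw [hx, hy, ih', List.singleton_perm_singleton.1 h1.symm]
  have := key x.length le_rfl
  rwa [List.take_length, hlen, List.take_length] at this

/-- A zero block in the derived read vector comes from a factor of length `2k + ℓ - 1` with
abelian period `k`. -/
theorem exists_mem_abelianPeriodicWords_of_hasZeroBlock {k ℓ : ℕ} (hk : 1 ≤ k) (hl : 1 ≤ ℓ)
    (hlk : ℓ ≤ k) {x : List (Fin q)} (hx : 2 * k + ℓ - 1 ≤ x.length)
    (h : HasZeroBlock k (kderiv k (readVec ℓ x))) :
    ∃ i, i + (2 * k + ℓ - 1) ≤ x.length ∧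
      (x.drop i).take (2 * k + ℓ - 1) ∈ abelianPeriodicWords (Fin q) k ℓ (k - 1) := by
  obtain ⟨s, hs, hz⟩ := h
  rw [length_kderiv, length_readVec] at hs
  have hzero : ∀ t < k, (kderiv k (readVec ℓ x)).getD (s + t) 0 = 0 := by
    intro t ht
    have h1 := congrArg (fun l => l.getD t 0) hz
    simpa [List.getD_eq_getElem?_getD, List.getElem?_take, ht, List.getElem?_replicate] using h1
  have hwin : ∀ t < k, comp ((x.take (s + t + 1)).drop (s + t + 1 - ℓ)) =
      if k ≤ s + t then comp ((x.take (s + t - k + 1)).drop (s + t - k + 1 - ℓ)) else 0 := by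
    intro t ht
    have h1 := hzero t ht
    rw [getD_kderiv (by rw [length_readVec]; omega), getD_readVec (by omega), sub_eq_zero] at h1
    rw [h1]
    split_ifs with hc
    · rw [getD_readVec (by omega)]
    · rfl
  have hks : k ≤ s := by
    by_contra hsk
    have h1 := hwin 0 (by omega)
    rw [if_neg (by omega), ← comp_nil, comp_eq_comp_iff] at h1
    have := h1.length_eq
    simp at this
    omega
  have hperm : ∀ t < k, ((x.take (s + t + 1)).drop (s + t + 1 - ℓ)).Perm
      ((x.take (s + t - k + 1)).drop (s + t - k + 1 - ℓ)) := by
    intro t ht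
    have h1 := hwin t ht
    rwa [if_pos (by omega), comp_eq_comp_iff] at h1
  have hsn : s + k ≤ x.length := by
    have := (hperm (k - 1) (by omega)).length_eq
    simp only [List.length_drop, List.length_take] at this
    omega
  have hsl : k + ℓ ≤ s + 1 := by
    have := (hperm 0 (by omega)).length_eq
    simp only [List.length_drop, List.length_take] at this
    omega
  refine ⟨s + 1 - k - ℓ, by omega, mem_abelianPeriodicWords.2 ⟨by simp; omega, ?_⟩⟩
  intro j hj
  have key : ∀ a b, b + ℓ ≤ 2 * k + ℓ - 1 → a + 1 = s + 1 - k - ℓ + b + ℓ →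
      (((x.drop (s + 1 - k - ℓ)).take (2 * k + ℓ - 1)).drop b).take ℓ =
        (x.take (a + 1)).drop (a + 1 - ℓ) := by
    intro a b hb hab
    rw [List.drop_take, List.take_take, List.drop_drop, List.drop_take, min_eq_left (by omega)]
    congr 1
    · omega
    · congr 1; omega
  rw [key (s + j) (k + j) (by omega) (by omega), key (s + j - k) j (by omega) (by omega)]
  exact hperm j (by omega)

end Words

section Nucleus

theorem replicate_infix_assemble {G : Type*} [Zero G] {ms : List ℕ} {as : List G} (h : ms.length = as.length + 1)
    {m : ℕ} (hm : m ∈ ms) : List.replicate m (0 : G) <:+: assemble ms as := by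
  induction ms generalizing as with
  | nil => simp at hm
  | cons r ms ih =>
    cases as with
    | nil =>
      obtain rfl : ms = [] := by simpa using h
      obtain rfl : m = r := by simpa using hm
      exact List.infix_rfl
    | cons a as =>
      rw [assemble]
      rcases List.mem_cons.1 hm with rfl | hm
      · exact (List.prefix_append _ _).isInfix
      · exact (ih (by simpa using h) hm).trans
          ((List.suffix_cons _ _).trans (List.suffix_append _ _)).isInfix

variable {G : Type*} [Zero G] [DecidableEq G]

theorem assemble_zeroRuns (y : List G) :
    (zeroRuns y).length = (y.filter fun a => decide (a ≠ 0)).length + 1 ∧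
      assemble (zeroRuns y) (y.filter fun a => decide (a ≠ 0)) = y := by
  induction y with
  | nil => simp [zeroRuns, assemble]
  | cons a y ih =>
    by_cases ha : a = 0
    · subst ha
      obtain ⟨m, ms, hm⟩ : ∃ m ms, zeroRuns y = m :: ms :=
        List.exists_cons_of_length_eq_add_one ih.1
      have hz : zeroRuns ((0 : G) :: y) = (m + 1) :: ms := by
        unfold zeroRuns at hm ⊢
        rw [List.splitOnP_cons_eq_if_modifyHead]
        cases hsp : y.splitOnP (fun a => decide (a ≠ 0)) with
        | nil => exact absurd hsp (List.splitOnP_ne_nil _ _)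
        | cons u us =>
          rw [hsp] at hm
          simp at hm
          simp [hm]
      rw [hm] at ih
      rw [hz, List.filter_cons_of_neg (by simp)]
      refine ⟨ih.1, ?_⟩
      conv_rhs => rw [← ih.2]
      cases y.filter fun a => decide (a ≠ 0) <;> simp [assemble, List.replicate_succ]
    · have hz : zeroRuns (a :: y) = 0 :: zeroRuns y := by
        simp [zeroRuns, List.splitOnP_cons_eq_if_modifyHead, ha]
      rw [hz, List.filter_cons_of_pos (by simpa using ha)]
      exact ⟨by simp [ih.1], by rw [assemble, ih.2]; simp⟩

theorem muk_eq_self {k : ℕ} {y : List G} (h : ¬HasZeroBlock k y) : muk k y = y := by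
  obtain ⟨hlen, hy⟩ := assemble_zeroRuns y
  have hlt : ∀ m ∈ zeroRuns y, m < k := by
    intro m hm
    by_contra hkm
    obtain ⟨s, t, hst⟩ := hy ▸ replicate_infix_assemble hlen hm
    refine h ⟨s.length, ?_, ?_⟩
    · rw [← hst]; simp; omega
    · rw [← hst, List.append_assoc, List.drop_left,
        List.take_append_of_le_length (by simp; omega), List.take_replicate,
        min_eq_left (by omega)]
  have hmap : ((zeroRuns y).map fun m => m % k) = zeroRuns y :=
    (List.map_congr_left fun m hm => Nat.mod_eq_of_lt (hlt m hm)).trans (List.map_id' _)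
  rw [muk, hmap, hy]

end Nucleus

theorem nucleus_injOn {q k ℓ n : ℕ} (hk : 1 ≤ k) (hl : 1 ≤ ℓ) :
    Set.InjOn (fun x : Fin n → Fin q => nucleus k ℓ (List.ofFn x))
      {x | ¬HasZeroBlock k (kderiv k (readVec ℓ (List.ofFn x)))} := by
  intro x hx y hy h
  simp only [nucleus, muk_eq_self hx, muk_eq_self hy] at h
  exact List.ofFn_injective (readVec_injective hl (by simp) (kderiv_injective hk h))

theorem card_avoidingWords_le_card_not_hasZeroBlock {q k ℓ n : ℕ} (hk : 1 ≤ k) (hl : 1 ≤ ℓ)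
    (hlk : ℓ ≤ k) (hn : 2 * k + ℓ - 1 ≤ n) :
    (avoidingWords (abelianPeriodicWords (Fin q) k ℓ (k - 1)) (2 * k + ℓ - 1) n).card ≤
      Nat.card {x : Fin n → Fin q //
        ¬HasZeroBlock k (kderiv k (readVec ℓ (List.ofFn x)))} := by
  have hsub : (avoidingWords (abelianPeriodicWords (Fin q) k ℓ (k - 1)) (2 * k + ℓ - 1) n :
      Set (List (Fin q))) ⊆ (fun x : Fin n → Fin q => List.ofFn x) ''
        {x | ¬HasZeroBlock k (kderiv k (readVec ℓ (List.ofFn x)))} := by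
    intro w hw
    obtain ⟨hlen, hw⟩ := mem_avoidingWords.1 (Finset.mem_coe.1 hw)
    subst hlen
    refine ⟨w.get, ?_, List.ofFn_get w⟩
    rw [Set.mem_ofPred_eq, List.ofFn_get]
    intro h
    obtain ⟨i, hi, hmem⟩ := exists_mem_abelianPeriodicWords_of_hasZeroBlock hk hl hlk hn h
    exact hw i hi hmem
  rw [← Set.ncard_coe_finset]
  exact (Set.ncard_le_ncard hsub (Set.toFinite _)).trans (Set.ncard_image_le (Set.toFinite _))

/-- The smaller root `c` of `2 * M * c ^ 2 - c + P = 0` satisfies the one-sided local lemma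
condition. -/
theorem smaller_root_bounds {M P c : ℝ} (hM : 1 ≤ M) (hP0 : 0 ≤ P) (hP : 8 * M * P ≤ 1)
    (hc : c = (1 - Real.sqrt (1 - 8 * M * P)) / (4 * M)) :
    0 ≤ c ∧ c ≤ 1 / 4 ∧ P = c * (1 - 2 * M * c) := by
  have hs := Real.sq_sqrt (show 0 ≤ 1 - 8 * M * P by linarith)
  have hs0 := Real.sqrt_nonneg (1 - 8 * M * P)
  have hs1 : Real.sqrt (1 - 8 * M * P) ≤ 1 := Real.sqrt_le_one.2 (by nlinarith)
  set s := Real.sqrt (1 - 8 * M * P)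
  refine ⟨?_, ?_, ?_⟩
  · rw [hc]
    exact div_nonneg (by linarith) (by linarith)
  · rw [hc, div_le_div_iff₀ (by linarith) (by norm_num)]
    linarith
  · have h4 : 4 * M * c = 1 - s := by rw [hc]; field_simp
    have h5 : s = 1 - 4 * M * c := by linarith
    rw [h5] at hs
    have : 8 * M * P = 8 * M * (c * (1 - 2 * M * c)) := by nlinarith
    exact mul_left_cancel₀ (by positivity) this

theorem le_liminf_logb_card_div {q L : ℕ} (hq : 2 ≤ q) {c : ℝ} (hc0 : 0 ≤ c) (hc1 : c < 1)
    {f : ℕ → ℕ} (hlow : ∀ n, L < n → (q : ℝ) ^ n * (1 - c) ^ (n - L) ≤ f n)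
    (hup : ∀ n, f n ≤ q ^ n) :
    1 - Real.logb q (1 / (1 - c)) ≤
      Filter.liminf (fun n : ℕ => Real.logb q (f n) / n) Filter.atTop := by
  have hq1 : (1 : ℝ) < q := by exact_mod_cast hq
  have hq0 : (0 : ℝ) < q := by linarith
  have hc' : 0 < 1 - c := by linarith
  have hself : Real.logb q q = 1 := Real.logb_self_eq_one hq1
  have hneg : Real.logb q (1 - c) ≤ 0 := Real.logb_nonpos hq1 hc'.le (by linarith)
  have hpos : ∀ n, L < n → (0 : ℝ) < f n := fun n hn =>
    (by positivity : 0 < (q : ℝ) ^ n * (1 - c) ^ (n - L)).trans_le (hlow n hn)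
  refine Filter.le_liminf_of_le ?_ ?_
  · refine (Filter.isBoundedUnder_of_eventually_le (a := 1) ?_).isCoboundedUnder_ge
    filter_upwards [Filter.eventually_gt_atTop L] with n hn
    have hn0 : (0 : ℝ) < n := by exact_mod_cast (Nat.zero_le L).trans_lt hn
    rw [div_le_one hn0]
    have h1 : Real.logb q (f n) ≤ Real.logb q ((q : ℝ) ^ n) :=
      Real.logb_le_logb_of_le hq1 (hpos n hn) (by exact_mod_cast hup n)
    rwa [Real.logb_pow, hself, mul_one] at h1
  · filter_upwards [Filter.eventually_gt_atTop L] with n hn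
    have hn0 : (0 : ℝ) < n := by exact_mod_cast (Nat.zero_le L).trans_lt hn
    have h1 : Real.logb q ((q : ℝ) ^ n * (1 - c) ^ (n - L)) ≤ Real.logb q (f n) :=
      Real.logb_le_logb_of_le hq1 (by positivity) (hlow n hn)
    rw [Real.logb_mul (by positivity) (by positivity), Real.logb_pow, Real.logb_pow, hself] at h1
    rw [le_div_iff₀ hn0, one_div, Real.logb_inv]
    have h2 : ((n - L : ℕ) : ℝ) ≤ n := by exact_mod_cast Nat.sub_le n L
    nlinarith

/-- Lovász Local Lemma bound, case `ℓ ≤ k`. -/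
theorem stmt_14 (q k ℓ : ℕ) (hk : 2 ≤ k) (hl : 2 ≤ ℓ) (hlk : ℓ ≤ k) (hq : 2 ≤ q)
    (hbig : (Nat.factorial ℓ : ℝ) * (16 * (k : ℝ) + 8 * (ℓ : ℝ) - 16) ≤
      (q : ℝ) ^ (k + ℓ - 1))
    (c : ℝ)
    (hc : c = (1 - Real.sqrt (1 -
        (Nat.factorial ℓ : ℝ) * (16 * (k : ℝ) + 8 * (ℓ : ℝ) - 16) /
          (q : ℝ) ^ (k + ℓ - 1))) / (8 * (k : ℝ) + 4 * (ℓ : ℝ) - 8)) :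
    (∀ n : ℕ, 2 * k + ℓ - 1 ≤ n →
        (q : ℝ) ^ n * (1 - c) ^ (n - (2 * k + ℓ - 2)) ≤
          (Nat.card {x : Fin n → Fin q //
            ¬HasZeroBlock k (kderiv k (readVec ℓ (List.ofFn x)))} : ℝ)) ∧
      1 - Real.logb q (1 / (1 - c)) ≤
        Filter.liminf
          (fun n : ℕ =>
            Real.logb q
                (Set.ncard
                  (Set.range fun x : Fin n → Fin q => nucleus k ℓ (List.ofFn x))) / n)
          Filter.atTop := by
  set L := 2 * k + ℓ - 2 with hL
  set M : ℝ := 2 * (k : ℝ) + ℓ - 2 with hM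
  have hLM : (L : ℝ) = M := by
    rw [hL, Nat.cast_sub (by omega)]
    push_cast
    rfl
  have hM1 : 1 ≤ M := by
    rw [← hLM]
    exact_mod_cast (show 1 ≤ L by omega)
  have hq0 : (0 : ℝ) < q := by positivity
  have hQ : (0 : ℝ) < (q : ℝ) ^ (k + ℓ - 1) := by positivity
  set P : ℝ := (ℓ.factorial : ℝ) / (q : ℝ) ^ (k + ℓ - 1) with hPdef
  have hPM : (ℓ.factorial : ℝ) * (16 * (k : ℝ) + 8 * (ℓ : ℝ) - 16) /
      (q : ℝ) ^ (k + ℓ - 1) = 8 * M * P := by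
    rw [hPdef, hM]; ring
  obtain ⟨hc0, hc4, hroot⟩ : 0 ≤ c ∧ c ≤ 1 / 4 ∧ P = c * (1 - 2 * M * c) := by
    refine smaller_root_bounds hM1 (by positivity) ?_ ?_
    · rw [← hPM]
      exact (div_le_one hQ).2 hbig
    · rw [hc, hPM, hM]
      congr 1
      ring
  have hB : ((abelianPeriodicWords (Fin q) k ℓ (k - 1)).card : ℝ) ≤
      (Fintype.card (Fin q) : ℝ) ^ (L + 1) * (c * (1 - c) ^ L) := by
    have h1 : ((abelianPeriodicWords (Fin q) k ℓ (k - 1)).card : ℝ) ≤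
        (q : ℝ) ^ k * ℓ.factorial := by
      have := card_abelianPeriodicWords_le (α := Fin q) (show 1 ≤ k by omega)
        (show 1 ≤ ℓ by omega) hlk (k - 1)
      rw [Fintype.card_fin] at this
      exact_mod_cast this
    have h2 : 1 - 2 * M * c ≤ (1 - c) ^ L := by
      have := one_add_mul_le_pow (show (-2 : ℝ) ≤ -c by linarith) L
      rw [hLM, ← sub_eq_add_neg] at this
      nlinarith [mul_nonneg (zero_le_one.trans hM1) hc0]
    have h3 : P ≤ c * (1 - c) ^ L := hroot.trans_le (mul_le_mul_of_nonneg_left h2 hc0)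
    rw [hPdef, div_le_iff₀ hQ] at h3
    rw [Fintype.card_fin]
    calc _ ≤ (q : ℝ) ^ k * ℓ.factorial := h1
      _ ≤ (q : ℝ) ^ k * (c * (1 - c) ^ L * (q : ℝ) ^ (k + ℓ - 1)) := by gcongr
      _ = _ := by
        rw [show L + 1 = k + (k + ℓ - 1) by omega, pow_add]; ring
  have hcount : ∀ n : ℕ, 2 * k + ℓ - 1 ≤ n → (q : ℝ) ^ n * (1 - c) ^ (n - L) ≤
      (Nat.card {x : Fin n → Fin q //
        ¬HasZeroBlock k (kderiv k (readVec ℓ (List.ofFn x)))} : ℝ) := by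
    intro n hn
    have h1 := pow_mul_le_card_avoidingWords _ L c hc0 (by linarith) hB (n - L)
    rw [Fintype.card_fin, show L + (n - L) = n by omega,
      show L + 1 = 2 * k + ℓ - 1 by omega] at h1
    exact h1.trans (by
      exact_mod_cast card_avoidingWords_le_card_not_hasZeroBlock (by omega) (by omega) hlk hn)
  refine ⟨hcount, le_liminf_logb_card_div (L := L) hq hc0 (by linarith) (fun n hn => ?_)
    fun n => ?_⟩
  · refine (hcount n (by omega)).trans ?_
    rw [Nat.cast_le]
    calc _ = Set.ncard {x : Fin n → Fin q |
          ¬HasZeroBlock k (kderiv k (readVec ℓ (List.ofFn x)))} := rfl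
      _ = _ := (nucleus_injOn (show 1 ≤ k by omega)
          (show 1 ≤ ℓ by omega)).ncard_image.symm
      _ ≤ _ := Set.ncard_le_ncard (Set.image_subset_range _ _) (Set.toFinite _)
  · rw [← Set.image_univ]
    refine (Set.ncard_image_le (Set.toFinite _)).trans ?_
    simp [Set.ncard_univ]
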